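/- arXiv:1908.10572 — 5 statements merged into one kernel-verified Lean document; each statement's English description precedes it below -/
import Mathlib

section
/- The thermodynamic identity holds: the log marginal likelihood equals the integral over inverse temperatures of the tempered-posterior expectation of the log-likelihood, i.e. log Z(1) = ∫_0^1 E^t[log L] dt. -/
open MeasureTheory Real

open ProbabilityTheory in
/-- If `exp (u * X)` is integrable for some `u > 1`, then the moment generating function of `X`
is continuous on the closed interval `[0, 1]`, including at the endpoint `0`. -/
theorem continuousOn_mgf_Icc {α : Type*} [MeasurableSpace α] {μ : Measure α} [IsFiniteMeasure μ]
    {X : α → ℝ} (h : 1 ∈ interior (integrableExpSet X μ)) :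
    ContinuousOn (mgf X μ) (Set.Icc 0 1) := by
  have hX := aemeasurable_of_mem_interior_integrableExpSet h
  have h1 : Integrable (fun ω => exp (1 * X ω)) μ :=
    interior_subset (s := integrableExpSet X μ) h
  refine continuousOn_of_dominated (bound := fun ω => 1 + exp (1 * X ω)) ?_ ?_ ?_ ?_
  · intro t _
    exact (measurable_exp.comp_aemeasurable (hX.const_mul t)).aestronglyMeasurable
  · intro t ht
    refine .of_forall fun ω => ?_
    rw [norm_of_nonneg (exp_pos _).le]
    rcases le_total 0 (X ω) with h0 | h0
    · have : exp (t * X ω) ≤ exp (1 * X ω) := exp_le_exp.2 (by nlinarith [ht.2])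
      linarith
    · have : exp (t * X ω) ≤ 1 := exp_le_one_iff.2 (by nlinarith [ht.1])
      linarith [exp_pos (1 * X ω)]
  · exact (integrable_const 1).add h1
  · exact .of_forall fun ω => by fun_prop

open ProbabilityTheory in
/-- The logarithm of the moment generating function at `1` is the integral over `[0, 1]` of the
mean of `X` under the exponentially tilted measures. -/
theorem log_mgf_one_eq_integral {α : Type*} [MeasurableSpace α] {μ : Measure α}
    [IsProbabilityMeasure μ] {X : α → ℝ} {u : ℝ} (hu : 1 < u) (h : u ∈ integrableExpSet X μ) :
    log (mgf X μ 1) =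
      ∫ t in (0 : ℝ)..1, (mgf X μ t)⁻¹ * ∫ ω, X ω * exp (t * X ω) ∂μ := by
  have hsub : Set.Icc 0 u ⊆ integrableExpSet X μ := fun t ht =>
    integrable_exp_mul_of_nonneg_of_le h ht.1 ht.2
  have hint : Set.Ioc 0 1 ⊆ interior (integrableExpSet X μ) := by
    intro t ht
    refine interior_mono hsub ?_
    rw [interior_Icc]
    exact ⟨ht.1, ht.2.trans_lt hu⟩
  have h1 := hint ⟨one_pos, le_rfl⟩
  have hpos : ∀ t ∈ Set.Icc (0 : ℝ) 1, 0 < mgf X μ t := fun t ht =>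
    mgf_pos (hsub ⟨ht.1, ht.2.trans hu.le⟩)
  have hcont := continuousOn_mgf_Icc h1
  have hderiv : ∀ t ∈ Set.Ioo (0 : ℝ) 1, HasDerivAt (mgf X μ) (μ[fun ω => X ω * exp (t * X ω)]) t :=
    fun t ht => hasDerivAt_mgf (hint ⟨ht.1, ht.2.le⟩)
  have hI : ∀ t ∈ Set.Ioc (0 : ℝ) 1, Integrable (fun ω => X ω * exp (t * X ω)) μ := fun t ht => by
    simpa using integrable_pow_mul_exp_of_mem_interior_integrableExpSet (hint ht) 1
  have hmono : ∀ t ∈ Set.Ioo (0 : ℝ) 1,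
      μ[fun ω => X ω * exp (t * X ω)] ≤ μ[fun ω => X ω * exp (1 * X ω)] := by
    intro t ht
    refine integral_mono (hI t ⟨ht.1, ht.2.le⟩) (hI 1 ⟨one_pos, le_rfl⟩) fun ω => ?_
    rcases le_total 0 (X ω) with h0 | h0
    · exact mul_le_mul_of_nonneg_left (exp_le_exp.2 (by nlinarith [ht.2])) h0
    · exact mul_le_mul_of_nonpos_left (exp_le_exp.2 (by nlinarith [ht.2])) h0
  set C := μ[fun ω => X ω * exp (1 * X ω)]
  have hM : IntegrableOn (fun t => μ[fun ω => X ω * exp (t * X ω)]) (Set.Ioc 0 1) := by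
    have := intervalIntegral.integrableOn_deriv_of_nonneg
      (g := fun t => C * t - mgf X μ t) (a := 0) (b := 1)
      (g' := fun t => C - μ[fun ω => X ω * exp (t * X ω)])
      (by fun_prop)
      (fun t ht => by simpa using! ((hasDerivAt_id t).const_mul C).sub (hderiv t ht))
      (fun t ht => sub_nonneg.2 (hmono t ht))
    have hC : IntegrableOn (fun _ : ℝ => C) (Set.Ioc 0 1) := by simp
    exact (hC.sub this).congr_fun (fun t _ => by simp) measurableSet_Ioc
  have hint' : IntervalIntegrable
      (fun t => (mgf X μ t)⁻¹ * ∫ ω, X ω * exp (t * X ω) ∂μ) volume 0 1 := by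
    refine IntervalIntegrable.continuousOn_mul
      ((intervalIntegrable_iff_integrableOn_Ioc_of_le zero_le_one).2 hM) ?_
    rw [Set.uIcc_of_le zero_le_one]
    exact hcont.inv₀ fun t ht => (hpos t ht).ne'
  rw [intervalIntegral.integral_eq_sub_of_hasDerivAt_of_le zero_le_one
    (f := fun t => log (mgf X μ t)) (hcont.log fun t ht => (hpos t ht).ne') ?_ hint']
  · simp
  · intro t ht
    have := (hderiv t ht).log (hpos t ⟨ht.1.le, ht.2.le⟩).ne'
    rwa [div_eq_inv_mul] at this

/-- the thermodynamic identity
`log Z(1) = ∫_0^1 E^t[log L] dt`, i.e. the log marginal likelihood is the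
integral over inverse temperatures of the tempered-posterior expectation of
the log-likelihood. -/
theorem wbic_thermodynamic_identity
    (d : ℕ) (hd : 1 ≤ d)
    (Ω : Set (Fin d → ℝ)) (hΩ : MeasurableSet Ω)
    (φ L : (Fin d → ℝ) → ℝ)
    (hφmeas : Measurable φ) (hφnonneg : ∀ θ, 0 ≤ φ θ)
    (hφprob : ∫ θ in Ω, φ θ = 1)
    (hLmeas : Measurable L) (hLpos : ∀ θ, 0 < L θ)
    (ε : ℝ) (hε : 0 < ε)
    (hZfin : ∀ t ∈ Set.Icc (0 : ℝ) (1 + ε),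
      IntegrableOn (fun θ => L θ ^ t * φ θ) Ω) :
    Real.log (∫ θ in Ω, L θ * φ θ) =
      ∫ t in (0 : ℝ)..1,
        (∫ θ in Ω, L θ ^ t * φ θ)⁻¹ *
          ∫ θ in Ω, Real.log (L θ) * (L θ ^ t * φ θ) := by
  have hφint : IntegrableOn φ Ω := by simpa using hZfin 0 ⟨le_rfl, by linarith⟩
  set μ := (volume.restrict Ω).withDensity fun θ => ENNReal.ofReal (φ θ)
  have hμ : ∀ f : (Fin d → ℝ) → ℝ, ∫ θ, f θ ∂μ = ∫ θ in Ω, f θ * φ θ := fun f => by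
    rw [integral_withDensity_eq_integral_toReal_smul hφmeas.ennreal_ofReal (by simp)]
    simp [ENNReal.toReal_ofReal (hφnonneg _), mul_comm]
  have hexp : ∀ t θ, exp (t * log (L θ)) = L θ ^ t := fun t θ => by
    rw [rpow_def_of_pos (hLpos θ), mul_comm]
  have : IsProbabilityMeasure μ := ⟨by
    rw [withDensity_apply _ .univ, Measure.restrict_univ,
      ← ofReal_integral_eq_lintegral_ofReal hφint (.of_forall hφnonneg), hφprob,
      ENNReal.ofReal_one]⟩
  have hu : 1 + ε ∈ ProbabilityTheory.integrableExpSet (fun θ => log (L θ)) μ := by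
    change Integrable _ _
    rw [integrable_withDensity_iff hφmeas.ennreal_ofReal (by simp)]
    simpa [hexp, ENNReal.toReal_ofReal (hφnonneg _), IntegrableOn] using
      hZfin (1 + ε) ⟨by linarith, le_rfl⟩
  have key := log_mgf_one_eq_integral (by linarith) hu
  simpa only [ProbabilityTheory.mgf, hμ, hexp, rpow_one, mul_assoc] using key
end

section
/- If log L is not almost everywhere constant with respect to the measure φ(θ)dθ on Ω, then the map t ↦ E^t[log L] is strictly increasing on (0, 1+ε). -/
open MeasureTheory Real

open ProbabilityTheory in
/-- The mean of `X` under the exponentially tilted measure is strictly increasing in the tilting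
parameter, unless `X` is almost everywhere constant. -/
theorem strictMonoOn_integral_mul_exp_div_mgf {α : Type*} [MeasurableSpace α] {μ : Measure α}
    {X : α → ℝ} (hX : ¬ ∃ c : ℝ, ∀ᵐ ω ∂μ, X ω = c) :
    StrictMonoOn (fun t => (mgf X μ t)⁻¹ * ∫ ω, X ω * exp (t * X ω) ∂μ)
      (interior (integrableExpSet X μ)) := by
  intro s hs t ht hst
  have hμ : μ ≠ 0 := by
    rintro rfl
    exact hX ⟨0, by simp⟩
  have int0 {u : ℝ} (hu : u ∈ interior (integrableExpSet X μ)) :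
      Integrable (fun ω => exp (u * X ω)) μ := interior_subset (s := integrableExpSet X μ) hu
  have int1 {u : ℝ} (hu : u ∈ interior (integrableExpSet X μ)) :
      Integrable (fun ω => X ω * exp (u * X ω)) μ := by
    simpa using integrable_pow_mul_exp_of_mem_interior_integrableExpSet hu 1
  have hZs : 0 < mgf X μ s := mgf_pos' hμ (int0 hs)
  have hZt : 0 < mgf X μ t := mgf_pos' hμ (int0 ht)
  dsimp only
  set c : ℝ := (mgf X μ s)⁻¹ * ∫ ω, X ω * exp (s * X ω) ∂μ with hc
  set k : ℝ := exp ((t - s) * c)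
  set g : α → ℝ := fun ω => (X ω - c) * (exp (t * X ω) - k * exp (s * X ω)) with hg
  have hg_factor (ω : α) :
      g ω = (X ω - c) * (exp ((t - s) * X ω) - exp ((t - s) * c)) * exp (s * X ω) := by
    have h : exp (t * X ω) = exp ((t - s) * X ω) * exp (s * X ω) := by
      rw [← exp_add]; ring_nf
    simp only [hg, h, k]
    ring
  have hg_nonneg (ω : α) : 0 ≤ g ω := by
    rw [hg_factor]
    refine mul_nonneg ?_ (exp_pos _).le
    rcases le_total (X ω) c with h | h
    · refine mul_nonneg_of_nonpos_of_nonpos (sub_nonpos.2 h) (sub_nonpos.2 (exp_le_exp.2 ?_))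
      exact mul_le_mul_of_nonneg_left h (sub_nonneg.2 hst.le)
    · refine mul_nonneg (sub_nonneg.2 h) (sub_nonneg.2 (exp_le_exp.2 ?_))
      exact mul_le_mul_of_nonneg_left h (sub_nonneg.2 hst.le)
  have hg_zero {ω : α} (h : g ω = 0) : X ω = c := by
    rw [hg_factor, mul_eq_zero, or_iff_left (exp_pos _).ne', mul_eq_zero, sub_eq_zero,
      sub_eq_zero, exp_eq_exp, mul_right_inj' (sub_pos.2 hst).ne'] at h
    exact h.elim id id
  have hg_eq : g = fun ω => (X ω * exp (t * X ω) - c * exp (t * X ω)) -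
      k * (X ω * exp (s * X ω) - c * exp (s * X ω)) := by
    funext ω
    simp only [hg]
    ring
  have hint {u : ℝ} (hu : u ∈ interior (integrableExpSet X μ)) :
      Integrable (fun ω => X ω * exp (u * X ω) - c * exp (u * X ω)) μ :=
    (int1 hu).sub ((int0 hu).const_mul c)
  have hval {u : ℝ} (hu : u ∈ interior (integrableExpSet X μ)) :
      ∫ ω, (X ω * exp (u * X ω) - c * exp (u * X ω)) ∂μ =
        (∫ ω, X ω * exp (u * X ω) ∂μ) - c * mgf X μ u := by
    rw [integral_sub (int1 hu) ((int0 hu).const_mul c), integral_const_mul]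
    rfl
  have hg_int : Integrable g μ := by
    rw [hg_eq]
    exact (hint ht).sub ((hint hs).const_mul k)
  have hs_zero : (∫ ω, X ω * exp (s * X ω) ∂μ) - c * mgf X μ s = 0 := by
    rw [hc, mul_right_comm, inv_mul_cancel₀ hZs.ne', one_mul, sub_self]
  have hg_integral : ∫ ω, g ω ∂μ = (∫ ω, X ω * exp (t * X ω) ∂μ) - c * mgf X μ t := by
    rw [hg_eq, integral_sub (hint ht) ((hint hs).const_mul k), integral_const_mul, hval ht,
      hval hs, hs_zero, mul_zero, sub_zero]
  have hg_pos : 0 < ∫ ω, g ω ∂μ := by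
    refine lt_of_le_of_ne (integral_nonneg hg_nonneg) fun h => hX ⟨c, ?_⟩
    filter_upwards [(integral_eq_zero_iff_of_nonneg hg_nonneg hg_int).1 h.symm] with ω hω
    exact hg_zero hω
  rw [inv_mul_eq_div, lt_div_iff₀ hZt]
  linarith

/-- if `log L` is not a.e. constant with respect to `φ(θ)dθ` on `Ω`,
then `t ↦ E^t[log L]` is strictly increasing on `(0, 1+ε)`. -/
theorem wbic_gibbs_expectation_strictMono
    (d : ℕ) (hd : 1 ≤ d)
    (Ω : Set (Fin d → ℝ)) (hΩ : MeasurableSet Ω)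
    (φ L : (Fin d → ℝ) → ℝ)
    (hφmeas : Measurable φ) (hφnonneg : ∀ θ, 0 ≤ φ θ)
    (hφprob : ∫ θ in Ω, φ θ = 1)
    (hLmeas : Measurable L) (hLpos : ∀ θ, 0 < L θ)
    (ε : ℝ) (hε : 0 < ε)
    (hZfin : ∀ t ∈ Set.Icc (0 : ℝ) (1 + ε),
      IntegrableOn (fun θ => L θ ^ t * φ θ) Ω)
    (hnotconst : ¬ ∃ c : ℝ,
      ∀ᵐ θ ∂((volume.restrict Ω).withDensity (fun θ => ENNReal.ofReal (φ θ))),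
        Real.log (L θ) = c) :
    StrictMonoOn
      (fun t => (∫ θ in Ω, L θ ^ t * φ θ)⁻¹ *
        ∫ θ in Ω, Real.log (L θ) * (L θ ^ t * φ θ))
      (Set.Ioo (0 : ℝ) (1 + ε)) := by
  set μ := (volume.restrict Ω).withDensity (fun θ => ENNReal.ofReal (φ θ)) with hμ
  have hexp (t : ℝ) (θ : Fin d → ℝ) : exp (t * log (L θ)) = L θ ^ t := by
    rw [rpow_def_of_pos (hLpos θ), mul_comm]
  have hintegral (f : (Fin d → ℝ) → ℝ) : ∫ θ, f θ ∂μ = ∫ θ in Ω, f θ * φ θ := by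
    rw [hμ, integral_withDensity_eq_integral_toReal_smul hφmeas.ennreal_ofReal
      (Filter.Eventually.of_forall fun _ => ENNReal.ofReal_lt_top)]
    simp [ENNReal.toReal_ofReal (hφnonneg _), mul_comm]
  have hsub : Set.Icc (0 : ℝ) (1 + ε) ⊆
      ProbabilityTheory.integrableExpSet (fun θ => log (L θ)) μ := by
    intro t ht
    change Integrable (fun θ => exp (t * log (L θ))) μ
    rw [hμ, integrable_withDensity_iff hφmeas.ennreal_ofReal
      (Filter.Eventually.of_forall fun _ => ENNReal.ofReal_lt_top)]
    simpa only [hexp, ENNReal.toReal_ofReal (hφnonneg _), IntegrableOn] using hZfin t ht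
  have hsub' := interior_mono hsub
  rw [interior_Icc] at hsub'
  have h := (strictMonoOn_integral_mul_exp_div_mgf hnotconst).mono hsub'
  simpa only [ProbabilityTheory.mgf, hintegral, hexp, mul_assoc] using h
end

section
/- There exists a unique inverse temperature t* ∈ (0, 1) such that the tempered-posterior expectation of the log-likelihood at t* equals the log marginal likelihood: E^{t*}[log L] = log Z(1). -/
open MeasureTheory Real

namespace ProbabilityTheory

variable {Ω : Type*} {m : MeasurableSpace Ω} {X : Ω → ℝ} {μ : Measure Ω} {a b t : ℝ}

lemma continuousOn_mgf_Icc (ha : a ∈ integrableExpSet X μ) (hb : b ∈ integrableExpSet X μ) :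
    ContinuousOn (mgf X μ) (Set.Icc a b) := by
  have htint : ∀ t ∈ Set.Icc a b, Integrable (fun ω ↦ exp (t * X ω)) μ :=
    fun t ht ↦ integrable_exp_mul_of_le_of_le ha hb ht.1 ht.2
  refine continuousOn_of_dominated (bound := fun ω ↦ exp (a * X ω) + exp (b * X ω))
    (fun t ht ↦ (htint t ht).aestronglyMeasurable) (fun t ht ↦ .of_forall fun ω ↦ ?_)
    (Integrable.add ha hb) (.of_forall fun ω ↦ by fun_prop)
  rw [norm_of_nonneg (exp_pos _).le]
  rcases le_total 0 (X ω) with h | h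
  · exact (exp_le_exp.2 (mul_le_mul_of_nonneg_right ht.2 h)).trans
      (le_add_of_nonneg_left (exp_pos _).le)
  · exact (exp_le_exp.2 (mul_le_mul_of_nonpos_right ht.1 h)).trans
      (le_add_of_nonneg_right (exp_pos _).le)

lemma continuousOn_cgf_Icc [NeZero μ] (ha : a ∈ integrableExpSet X μ)
    (hb : b ∈ integrableExpSet X μ) : ContinuousOn (cgf X μ) (Set.Icc a b) :=
  (continuousOn_mgf_Icc ha hb).log fun _ ht ↦
    (mgf_pos' (NeZero.ne μ) (integrable_exp_mul_of_le_of_le ha hb ht.1 ht.2)).ne'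

lemma iteratedDeriv_two_cgf_pos (ht : t ∈ interior (integrableExpSet X μ))
    (hX : ¬ ∃ c : ℝ, ∀ᵐ ω ∂μ, X ω = c) : 0 < iteratedDeriv 2 (cgf X μ) t := by
  have hexp : Integrable (fun ω ↦ exp (t * X ω)) μ :=
    interior_subset (s := integrableExpSet X μ) ht
  have : NeZero μ := ⟨fun h ↦ hX ⟨0, by simp [h]⟩⟩
  have : IsProbabilityMeasure (μ.tilted (t * X ·)) := isProbabilityMeasure_tilted hexp
  have hL : MemLp X 2 (μ.tilted (t * X ·)) := memLp_tilted_mul ht 2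
  rw [← variance_tilted_mul ht]
  refine (variance_nonneg _ _).lt_of_ne' fun h ↦ hX ?_
  have hev : evariance X (μ.tilted (t * X ·)) = 0 := by
    rw [← hL.ofReal_variance_eq, h, ENNReal.ofReal_zero]
  exact ⟨_, (absolutelyContinuous_tilted hexp).ae_le
    ((evariance_eq_zero_iff hL.aestronglyMeasurable.aemeasurable).1 hev)⟩

lemma strictMonoOn_deriv_cgf (hX : ¬ ∃ c : ℝ, ∀ᵐ ω ∂μ, X ω = c) :
    StrictMonoOn (deriv (cgf X μ)) (interior (integrableExpSet X μ)) := by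
  refine strictMonoOn_of_deriv_pos convex_integrableExpSet.interior
    analyticOnNhd_cgf.deriv.continuousOn fun t ht ↦ ?_
  rw [interior_interior] at ht
  simpa only [iteratedDeriv_succ, iteratedDeriv_zero] using iteratedDeriv_two_cgf_pos ht hX

lemma existsUnique_deriv_cgf_eq_slope (hab : a < b) (ha : a ∈ integrableExpSet X μ)
    (hb : b ∈ integrableExpSet X μ) (hX : ¬ ∃ c : ℝ, ∀ᵐ ω ∂μ, X ω = c) :
    ∃! t, t ∈ Set.Ioo a b ∧ deriv (cgf X μ) t = (cgf X μ b - cgf X μ a) / (b - a) := by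
  have : NeZero μ := ⟨fun h ↦ hX ⟨0, by simp [h]⟩⟩
  have hsub : Set.Ioo a b ⊆ interior (integrableExpSet X μ) :=
    interior_maximal (fun t ht ↦ convex_integrableExpSet.ordConnected.out ha hb
      (Set.Ioo_subset_Icc_self ht)) isOpen_Ioo
  obtain ⟨t, ht, hslope⟩ := exists_deriv_eq_slope (cgf X μ) hab (continuousOn_cgf_Icc ha hb)
    fun t ht ↦ (analyticAt_cgf (hsub ht)).differentiableAt.differentiableWithinAt
  exact ⟨t, ⟨ht, hslope⟩, fun s hs ↦ (strictMonoOn_deriv_cgf hX).injOn (hsub hs.1) (hsub ht)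
    (hs.2.trans hslope.symm)⟩

end ProbabilityTheory


/-- there exists a unique inverse temperature `t* ∈ (0, 1)` such
that the tempered-posterior expectation of the log-likelihood at `t*` equals
the log marginal likelihood `log Z(1)`. -/
theorem wbic_exists_unique_temperature
    (d : ℕ) (hd : 1 ≤ d)
    (Ω : Set (Fin d → ℝ)) (hΩ : MeasurableSet Ω)
    (φ L : (Fin d → ℝ) → ℝ)
    (hφmeas : Measurable φ) (hφnonneg : ∀ θ, 0 ≤ φ θ)
    (hφprob : ∫ θ in Ω, φ θ = 1)
    (hLmeas : Measurable L) (hLpos : ∀ θ, 0 < L θ)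
    (ε : ℝ) (hε : 0 < ε)
    (hZfin : ∀ t ∈ Set.Icc (0 : ℝ) (1 + ε),
      IntegrableOn (fun θ => L θ ^ t * φ θ) Ω)
    (hnotconst : ¬ ∃ c : ℝ,
      ∀ᵐ θ ∂((volume.restrict Ω).withDensity (fun θ => ENNReal.ofReal (φ θ))),
        Real.log (L θ) = c) :
    ∃! t : ℝ, t ∈ Set.Ioo (0 : ℝ) 1 ∧
      (∫ θ in Ω, L θ ^ t * φ θ)⁻¹ *
          ∫ θ in Ω, Real.log (L θ) * (L θ ^ t * φ θ) =
        Real.log (∫ θ in Ω, L θ * φ θ) := by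
  set ν := (volume.restrict Ω).withDensity (fun θ => ENNReal.ofReal (φ θ))
  have hdens : Measurable fun θ ↦ ENNReal.ofReal (φ θ) := hφmeas.ennreal_ofReal
  have hfin : ∀ᵐ θ ∂volume.restrict Ω, ENNReal.ofReal (φ θ) < ⊤ := by simp
  have hν (f : (Fin d → ℝ) → ℝ) : ∫ θ, f θ ∂ν = ∫ θ in Ω, f θ * φ θ := by
    rw [integral_withDensity_eq_integral_toReal_smul hdens hfin]
    simp only [ENNReal.toReal_ofReal (hφnonneg _), smul_eq_mul, mul_comm]
  have hexp (t : ℝ) (θ : Fin d → ℝ) : exp (t * log (L θ)) = L θ ^ t := by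
    rw [rpow_def_of_pos (hLpos θ), mul_comm]
  have hmem : ∀ t ∈ Set.Icc (0 : ℝ) (1 + ε),
      t ∈ ProbabilityTheory.integrableExpSet (fun θ ↦ log (L θ)) ν := fun t ht ↦ by
    have h := (hZfin t ht).integrable
    simp only [ProbabilityTheory.integrableExpSet, Set.mem_ofPred_eq, hexp]
    rw [integrable_withDensity_iff hdens hfin]
    simpa only [ENNReal.toReal_ofReal (hφnonneg _)] using h
  have h0 := hmem 0 ⟨le_rfl, by linarith⟩
  have h1 := hmem 1 ⟨zero_le_one, by linarith⟩
  have hmgf (t : ℝ) : ProbabilityTheory.mgf (fun θ ↦ log (L θ)) ν t = ∫ θ in Ω, L θ ^ t * φ θ := by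
    simp only [ProbabilityTheory.mgf, hexp, hν]
  have hslope : (ProbabilityTheory.cgf (fun θ ↦ log (L θ)) ν 1 -
      ProbabilityTheory.cgf (fun θ ↦ log (L θ)) ν 0) / (1 - 0) = log (∫ θ in Ω, L θ * φ θ) := by
    simp [ProbabilityTheory.cgf, hmgf, hφprob]
  have key := ProbabilityTheory.existsUnique_deriv_cgf_eq_slope zero_lt_one h0 h1 hnotconst
  rw [hslope] at key
  refine (existsUnique_congr fun t ↦ and_congr_right fun ht ↦ ?_).1 key
  have htint : t ∈ interior (ProbabilityTheory.integrableExpSet (fun θ ↦ log (L θ)) ν) :=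
    interior_maximal (fun s hs ↦ hmem s ⟨hs.1.le, by linarith [hs.2]⟩) isOpen_Ioo ht
  rw [ProbabilityTheory.deriv_cgf htint, hmgf, hν, div_eq_inv_mul]
  simp only [hexp, mul_assoc]
end

section
/- For every t > 0, the estimated singular fluctuation of model M_N has the closed form ν̂(t) := (t/2) ∑_{i=1}^n V^t[ log p(x_i | θ) ] = ((ntv − tv)/(ntv + 1)) · s_x²/2 + (ntv/(2(ntv + 1)³)) · (m − x̄)² + t n v²/(4(ntv + 1)²), where s_x² = (n−1)^{-1} ∑_{i=1}^n (x_i − x̄)². -/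
open MeasureTheory ProbabilityTheory Real

/-- Normal likelihood density `p(x | θ) = (2π)^{-1/2} exp(−(x−θ)²/2)`. -/
noncomputable def normalLik (x θ : ℝ) : ℝ :=
  (Real.sqrt (2 * Real.pi))⁻¹ * Real.exp (-(x - θ)^2 / 2)

open scoped NNReal

/-- The mean-zero Gaussian moments of order three and four. -/
lemma integral_pow_three_and_four_gaussianReal (v : ℝ≥0) :
    ∫ z, z ^ 3 ∂(gaussianReal 0 v) = 0 ∧ ∫ z, z ^ 4 ∂(gaussianReal 0 v) = 3 * (v : ℝ) ^ 2 := by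
  have hmem (k : ℕ) : ∫ z, z ^ k ∂(gaussianReal 0 v) =
      iteratedDeriv k (fun s : ℝ ↦ rexp (v * s ^ 2 / 2)) 0 := by
    have h := iteratedDeriv_mgf_zero (X := fun z : ℝ ↦ z) (μ := gaussianReal 0 v)
      (by rw [integrableExpSet_fun_id_gaussianReal]; simp) k
    rw [mgf_fun_id_gaussianReal] at h
    simpa using h.symm
  have hexp (s : ℝ) : HasDerivAt (fun s : ℝ ↦ rexp (v * s ^ 2 / 2))
      (rexp (v * s ^ 2 / 2) * (v * s)) s := by
    convert ((((hasDerivAt_id' s).fun_pow 2).const_mul (v : ℝ)).div_const 2).exp using 1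
    ring
  have hpoly (p p' : ℝ → ℝ) (hp : ∀ s, HasDerivAt p (p' s) s) :
      deriv (fun s : ℝ ↦ p s * rexp (v * s ^ 2 / 2)) =
        fun s ↦ (p' s + p s * (v * s)) * rexp (v * s ^ 2 / 2) := by
    funext s
    rw [((hp s).fun_mul (hexp s)).deriv]
    ring
  have h1 : deriv (fun s : ℝ ↦ rexp (v * s ^ 2 / 2)) =
      fun s ↦ (v * s) * rexp (v * s ^ 2 / 2) := by
    funext s
    rw [(hexp s).deriv, mul_comm]
  have h2 := hpoly (fun s ↦ v * s) (fun _ ↦ v) (fun s ↦ by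
    simpa using (hasDerivAt_id' s).const_mul (v : ℝ))
  have h3 := hpoly (fun s ↦ v + v * s * (v * s)) (fun s ↦ 2 * v ^ 2 * s) (fun s ↦ by
    have h := (hasDerivAt_id' s).const_mul (v : ℝ)
    exact ((h.fun_mul h).const_add (v : ℝ)).congr_deriv (by ring))
  have h4 := hpoly (fun s ↦ 2 * v ^ 2 * s + (v + v * s * (v * s)) * (v * s))
    (fun s ↦ 3 * v ^ 2 + 3 * v ^ 3 * s ^ 2) (fun s ↦ by
    have h := (hasDerivAt_id' s).const_mul (v : ℝ)
    exact (((hasDerivAt_id' s).const_mul (2 * (v : ℝ) ^ 2)).fun_add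
      (((h.fun_mul h).const_add (v : ℝ)).fun_mul h)).congr_deriv (by ring))
  constructor
  · simp [hmem, iteratedDeriv_succ, h1, h2, h3]
  · simp [hmem, iteratedDeriv_succ, h1, h2, h3, h4]

lemma integral_quartic_gaussianReal (v : ℝ≥0) (c₀ c₁ c₂ c₃ c₄ : ℝ) :
    ∫ z, (c₀ + c₁ * z + c₂ * z ^ 2 + c₃ * z ^ 3 + c₄ * z ^ 4) ∂(gaussianReal 0 v) =
      c₀ + c₂ * v + c₄ * (3 * (v : ℝ) ^ 2) := by
  have hint (k : ℕ) (c : ℝ) : Integrable (fun z : ℝ ↦ c * z ^ k) (gaussianReal 0 v) := by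
    refine Integrable.const_mul ?_ c
    have h := (memLp_id_gaussianReal' (μ := 0) (v := v) k (by simp)).integrable_norm_pow'
    exact h.mono' (by fun_prop) (by simp)
  have h1 : Integrable (fun z : ℝ ↦ c₁ * z) (gaussianReal 0 v) := by simpa using hint 1 c₁
  have hsq : ∫ z, z ^ 2 ∂(gaussianReal 0 v) = v := by
    have h := variance_fun_id_gaussianReal (μ := 0) (v := v)
    rw [variance_eq_integral (by fun_prop)] at h
    simpa using h
  obtain ⟨h3, h4⟩ := integral_pow_three_and_four_gaussianReal v
  rw [integral_add (by fun_prop) (hint 4 c₄), integral_add (by fun_prop) (hint 3 c₃),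
    integral_add (by fun_prop) (hint 2 c₂), integral_add (by fun_prop) h1]
  rw [integral_const_mul c₁ (fun z ↦ z)]
  simp [integral_const_mul, hsq, h3, h4]

lemma log_normalLik (x θ : ℝ) :
    Real.log (normalLik x θ) = -Real.log (√(2 * π)) - (x - θ) ^ 2 / 2 := by
  rw [normalLik, Real.log_mul (by positivity) (by positivity), Real.log_inv, Real.log_exp]
  ring

lemma integral_gaussianReal_eq_integral_const_add (μ : ℝ) (v : ℝ≥0) (f : ℝ → ℝ) :
    ∫ θ, f θ ∂(gaussianReal μ v) = ∫ z, f (μ + z) ∂(gaussianReal 0 v) := by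
  have h := gaussianReal_map_const_add (μ := 0) (v := v) μ
  rw [zero_add] at h
  rw [← h, (measurableEmbedding_addLeft μ).integral_map]

/-- The variance of the normal log-likelihood under a Gaussian law of its mean. -/
lemma variance_log_normalLik (x μ : ℝ) (v : ℝ≥0) :
    ∫ θ, (Real.log (normalLik x θ)) ^ 2 ∂(gaussianReal μ v) -
      (∫ θ, Real.log (normalLik x θ) ∂(gaussianReal μ v)) ^ 2 =
      v * (x - μ) ^ 2 + (v : ℝ) ^ 2 / 2 := by
  simp only [log_normalLik]
  rw [integral_gaussianReal_eq_integral_const_add μ,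
    integral_gaussianReal_eq_integral_const_add μ]
  generalize -Real.log (√(2 * π)) = L
  have hone (z : ℝ) : L - (x - (μ + z)) ^ 2 / 2 = (L - (x - μ) ^ 2 / 2) + (x - μ) * z
      + (-1 / 2) * z ^ 2 + 0 * z ^ 3 + 0 * z ^ 4 := by ring
  have htwo (z : ℝ) : (L - (x - (μ + z)) ^ 2 / 2) ^ 2 = (L - (x - μ) ^ 2 / 2) ^ 2
      + (2 * (L - (x - μ) ^ 2 / 2) * (x - μ)) * z
      + ((x - μ) ^ 2 - (L - (x - μ) ^ 2 / 2)) * z ^ 2 + (-(x - μ)) * z ^ 3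
      + (1 / 4) * z ^ 4 := by ring
  simp_rw [htwo, hone]
  rw [integral_quartic_gaussianReal, integral_quartic_gaussianReal]
  ring

/-- The sum of squares about `c` splits into that about the mean and the offset of the mean. -/
lemma sum_sq_sub_eq_add_sq_mean_sub {n : ℕ} (hn : n ≠ 0) (x : Fin n → ℝ) (c xbar : ℝ)
    (hxbar : xbar = (∑ i, x i) / n) :
    ∑ i, (x i - c) ^ 2 = ∑ i, (x i - xbar) ^ 2 + n * (xbar - c) ^ 2 := by
  have hsum : ∑ i, x i = n * xbar := by
    rw [hxbar]; field_simp
  have hsplit (i : Fin n) : (x i - c) ^ 2 =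
      (x i - xbar) ^ 2 + (2 * (xbar - c) * x i + (c ^ 2 - xbar ^ 2)) := by ring
  simp_rw [hsplit, Finset.sum_add_distrib, ← Finset.mul_sum, hsum]
  simp
  ring

/-- closed form of the estimated singular fluctuation of model
`M_N`: `ν̂(t) = (t/2)∑ᵢ V^t[log p(xᵢ|θ)]`, the variances being taken under the
tempered posterior `N(m_t, v_t)`, equals
`((ntv−tv)/(ntv+1))·s_x²/2 + (ntv/(2(ntv+1)³))·(m−x̄)² + tnv²/(4(ntv+1)²)`. -/
theorem normal_nuhat_closed_form
    (n : ℕ) (hn : 2 ≤ n) (x : Fin n → ℝ) (m v : ℝ) (hv : 0 < v)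
    (t : ℝ) (ht : 0 < t)
    (xbar mt vt sx2 : ℝ)
    (hxbar : xbar = (∑ i, x i) / n)
    (hmt : mt = (n * t * xbar + m / v) / (n * t + 1 / v))
    (hvt : vt = (n * t + 1 / v)⁻¹)
    (hsx2 : sx2 = (∑ i, (x i - xbar)^2) / ((n : ℝ) - 1)) :
    (t / 2) * ∑ i,
        ((∫ θ, (Real.log (normalLik (x i) θ))^2 ∂(gaussianReal mt vt.toNNReal)) -
          (∫ θ, Real.log (normalLik (x i) θ) ∂(gaussianReal mt vt.toNNReal))^2) =
      ((n * t * v - t * v) / (n * t * v + 1)) * (sx2 / 2) +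
        (n * t * v / (2 * (n * t * v + 1)^3)) * (m - xbar)^2 +
        t * n * v^2 / (4 * (n * t * v + 1)^2) := by
  have hn0 : (n : ℝ) - 1 ≠ 0 := by
    have : (2 : ℝ) ≤ n := by exact_mod_cast hn
    linarith
  have hden : 0 < n * t * v + 1 := by positivity
  have hvt' : vt = v / (n * t * v + 1) := by
    rw [hvt]; field_simp
  have hmean : xbar - mt = (xbar - m) / (n * t * v + 1) := by
    rw [hmt]; field_simp; ring
  have hcoe : (vt.toNNReal : ℝ) = vt := Real.coe_toNNReal _ (by rw [hvt']; positivity)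
  have hss : ∑ i, (x i - xbar) ^ 2 = (n - 1) * sx2 := by
    rw [hsx2]; field_simp
  simp_rw [variance_log_normalLik, hcoe, Finset.sum_add_distrib, ← Finset.mul_sum]
  rw [sum_sq_sub_eq_add_sq_mean_sub (by omega) x mt xbar hxbar, hss, hmean, hvt']
  simp only [Finset.sum_const, Finset.card_univ, Fintype.card_fin, nsmul_eq_mul]
  field_simp
  ring
end

section
/- The log marginal likelihood of the Bayesian linear regression model with conjugate normal–gamma prior has the exact closed form: log ∫_0^∞ ∫_{ℝ^d} (2π)^{-n/2} τ^{n/2} exp(−(τ/2)‖y − Xβ‖²) · (2π)^{-d/2} τ^{d/2} (det Q)^{1/2} exp(−(τ/2) βᵀQβ) · ((b/2)^{a/2}/Γ(a/2)) τ^{a/2−1} exp(−(b/2)τ) dβ dτ = −(n/2) log π + (a/2) log b + log( Γ((n+a)/2) / Γ(a/2) ) + (1/2) log( det Q / det M ) − ((n+a)/2) log( yᵀRy + b ), where M = XᵀX + Q and R = I_n − X M^{-1} Xᵀ. -/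
open MeasureTheory Real Matrix

/-- The Gaussian integral of a positive definite quadratic form. -/
theorem integral_exp_neg_half_mul_quadratic {ι : Type*} [Fintype ι] [DecidableEq ι]
    {M : Matrix ι ι ℝ} (hM : M.PosDef) (t : ℝ) :
    ∫ v : ι → ℝ, Real.exp (-(t / 2) * (v ⬝ᵥ M.mulVec v)) =
      (√M.det)⁻¹ * √(2 * π / t) ^ Fintype.card ι := by
  open scoped MatrixOrder in
  obtain ⟨S, rfl⟩ := CStarAlgebra.nonneg_iff_eq_star_mul_self.mp hM.posSemidef.nonneg
  have hdet : (star S * S).det = S.det ^ 2 := by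
    rw [star_eq_conjTranspose, conjTranspose_eq_transpose_of_trivial, det_mul, det_transpose, sq]
  have hS : S.det ≠ 0 := fun h ↦ hM.det_pos.ne' (by rw [hdet, h]; norm_num)
  have hquad (v : ι → ℝ) : v ⬝ᵥ (star S * S).mulVec v = ∑ i, (S.mulVec v i) ^ 2 := by
    rw [star_eq_conjTranspose, conjTranspose_eq_transpose_of_trivial, ← mulVec_mulVec,
      dotProduct_mulVec, vecMul_transpose]
    simp [dotProduct, sq]
  have hint : ∫ w : ι → ℝ, Real.exp (-(t / 2) * ∑ i, w i ^ 2) =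
      √(2 * π / t) ^ Fintype.card ι := by
    simp_rw [Finset.mul_sum, Real.exp_sum]
    rw [integral_fintype_prod_volume_eq_pow (fun x : ℝ ↦ Real.exp (-(t / 2) * x ^ 2)),
      integral_gaussian]
    congr 2
    field_simp
  have hmap := integral_map (μ := volume) (φ := toLin' S)
    (f := fun w : ι → ℝ ↦ Real.exp (-(t / 2) * ∑ i, w i ^ 2))
    (LinearMap.continuous_of_finiteDimensional _).aemeasurable
    (by fun_prop : Continuous _).aestronglyMeasurable
  rw [Real.map_matrix_volume_pi_eq_smul_volume_pi hS, integral_smul_measure, hint,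
    ENNReal.toReal_ofReal (abs_nonneg _), smul_eq_mul] at hmap
  simp_rw [hquad]
  rw [hdet, Real.sqrt_sq_eq_abs, ← abs_inv, hmap]
  simp only [toLin'_apply]

/-- Completing the square in the ridge regression objective. -/
theorem sum_sq_sub_mulVec_add_quadratic {m ι : Type*} [Fintype m] [DecidableEq m] [Fintype ι]
    [DecidableEq ι] (y : m → ℝ) (X : Matrix m ι ℝ) {Q M : Matrix ι ι ℝ} (hM : M = Xᵀ * X + Q)
    (hsymm : Mᵀ = M) (hdet : IsUnit M.det) (β : ι → ℝ) :
    ∑ i, (y i - X.mulVec β i) ^ 2 + β ⬝ᵥ Q.mulVec β =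
      (β - M⁻¹.mulVec (Xᵀ.mulVec y)) ⬝ᵥ M.mulVec (β - M⁻¹.mulVec (Xᵀ.mulVec y)) +
        y ⬝ᵥ (1 - X * M⁻¹ * Xᵀ).mulVec y := by
  set μ := M⁻¹.mulVec (Xᵀ.mulVec y) with hμ
  have hMμ : M.mulVec μ = Xᵀ.mulVec y := by
    rw [hμ, mulVec_mulVec, mul_nonsing_inv _ hdet, one_mulVec]
  have hsq : ∑ i, (y i - X.mulVec β i) ^ 2 = (y - X.mulVec β) ⬝ᵥ (y - X.mulVec β) := by
    simp [dotProduct, sq]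
  have hXX : β ⬝ᵥ M.mulVec β = X.mulVec β ⬝ᵥ X.mulVec β + β ⬝ᵥ Q.mulVec β := by
    rw [hM, add_mulVec, dotProduct_add, ← mulVec_mulVec, dotProduct_mulVec, vecMul_transpose]
  have hμβ : μ ⬝ᵥ M.mulVec β = β ⬝ᵥ Xᵀ.mulVec y := by
    rw [dotProduct_mulVec, ← mulVec_transpose, hsymm, hMμ, dotProduct_comm]
  have hβy : β ⬝ᵥ Xᵀ.mulVec y = y ⬝ᵥ X.mulVec β := by
    rw [dotProduct_mulVec, vecMul_transpose, dotProduct_comm]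
  have hμy : μ ⬝ᵥ Xᵀ.mulVec y = y ⬝ᵥ X.mulVec μ := by
    rw [dotProduct_mulVec, vecMul_transpose, dotProduct_comm]
  have hR : y ⬝ᵥ (1 - X * M⁻¹ * Xᵀ).mulVec y = y ⬝ᵥ y - y ⬝ᵥ X.mulVec μ := by
    rw [sub_mulVec, one_mulVec, dotProduct_sub, hμ, mulVec_mulVec, mulVec_mulVec]
  rw [hsq, hR, mulVec_sub, hMμ]
  simp only [sub_dotProduct, dotProduct_sub]
  rw [hXX, hμβ, hμy, hβy, dotProduct_comm (X.mulVec β) y]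
  ring

/-- exact closed form of the log marginal likelihood of the
Bayesian linear regression model `y | β, τ ~ N(Xβ, τ⁻¹Iₙ)` with conjugate
normal–gamma prior `β | τ ~ N(0, (τQ)⁻¹)`, `τ ~ Gamma(a/2, rate b/2)`:
`log ∫₀^∞ ∫_{ℝᵈ} likelihood · prior dβ dτ
  = −(n/2)log π + (a/2)log b + log(Γ((n+a)/2)/Γ(a/2))
    + (1/2)log(det Q/det M) − ((n+a)/2) log(yᵀRy + b)`,
with `M = XᵀX + Q` and `R = Iₙ − XM⁻¹Xᵀ`. -/
theorem linear_regression_log_marginal_likelihood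
    (n d : ℕ) (y : Fin n → ℝ)
    (X : Matrix (Fin n) (Fin d) ℝ)
    (Q : Matrix (Fin d) (Fin d) ℝ) (hQ : Q.PosDef)
    (a b : ℝ) (ha : 0 < a) (hb : 0 < b)
    (M : Matrix (Fin d) (Fin d) ℝ) (hM : M = Xᵀ * X + Q)
    (R : Matrix (Fin n) (Fin n) ℝ) (hR : R = 1 - X * M⁻¹ * Xᵀ) :
    Real.log
      (∫ τ in Set.Ioi (0 : ℝ), ∫ β : Fin d → ℝ,
        ((2 * Real.pi) ^ (-(n : ℝ) / 2) * τ ^ ((n : ℝ) / 2) *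
            Real.exp (-(τ / 2) * ∑ i, (y i - X.mulVec β i)^2)) *
          ((2 * Real.pi) ^ (-(d : ℝ) / 2) * τ ^ ((d : ℝ) / 2) *
            Real.sqrt Q.det * Real.exp (-(τ / 2) * (β ⬝ᵥ Q.mulVec β))) *
          ((b / 2) ^ (a / 2) / Real.Gamma (a / 2) * τ ^ (a / 2 - 1) *
            Real.exp (-(b / 2) * τ))) =
      -((n : ℝ) / 2) * Real.log Real.pi + (a / 2) * Real.log b +
        Real.log (Real.Gamma ((n + a) / 2) / Real.Gamma (a / 2)) +
        (1 / 2) * Real.log (Q.det / M.det) -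
        ((n + a) / 2) * Real.log (y ⬝ᵥ R.mulVec y + b) := by
  have hMpos : M.PosDef := by
    rw [hM, ← conjTranspose_eq_transpose_of_trivial]
    exact PosDef.posSemidef_add (posSemidef_conjTranspose_mul_self X) hQ
  have hsymm : Mᵀ = M := by
    rw [← conjTranspose_eq_transpose_of_trivial]; exact hMpos.isHermitian
  have hsquare := sum_sq_sub_mulVec_add_quadratic y X hM hsymm hMpos.det_pos.ne'.isUnit
  rw [← hR] at hsquare
  set μ := M⁻¹.mulVec (Xᵀ.mulVec y)
  have hr : 0 ≤ y ⬝ᵥ R.mulVec y := by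
    have h := hsquare μ
    rw [sub_self, zero_dotProduct, zero_add] at h
    rw [← h]
    have hμ : 0 ≤ μ ⬝ᵥ Q.mulVec μ := by
      simpa using hQ.posSemidef.dotProduct_mulVec_nonneg μ
    positivity
  set r := y ⬝ᵥ R.mulVec y
  have hs : 0 < r + b := by positivity
  have hp : 0 < ((n : ℝ) + a) / 2 := by positivity
  have hQd := hQ.det_pos
  have hMd := hMpos.det_pos
  have hΓ := Real.Gamma_pos_of_pos hp
  have hΓa := Real.Gamma_pos_of_pos (half_pos ha)
  have hinner : ∀ τ ∈ Set.Ioi (0 : ℝ), (∫ β : Fin d → ℝ,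
        ((2 * Real.pi) ^ (-(n : ℝ) / 2) * τ ^ ((n : ℝ) / 2) *
            Real.exp (-(τ / 2) * ∑ i, (y i - X.mulVec β i)^2)) *
          ((2 * Real.pi) ^ (-(d : ℝ) / 2) * τ ^ ((d : ℝ) / 2) *
            Real.sqrt Q.det * Real.exp (-(τ / 2) * (β ⬝ᵥ Q.mulVec β))) *
          ((b / 2) ^ (a / 2) / Real.Gamma (a / 2) * τ ^ (a / 2 - 1) *
            Real.exp (-(b / 2) * τ))) =
      ((2 * π) ^ (-(n : ℝ) / 2) * (b / 2) ^ (a / 2) / Real.Gamma (a / 2) * √Q.det * (√M.det)⁻¹) *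
        (τ ^ (((n : ℝ) + a) / 2 - 1) * Real.exp (-((r + b) / 2 * τ))) := by
    intro τ hτ
    have hτ : 0 < τ := hτ
    have hexp (β : Fin d → ℝ) :
        Real.exp (-(τ / 2) * ∑ i, (y i - X.mulVec β i)^2) *
          Real.exp (-(τ / 2) * (β ⬝ᵥ Q.mulVec β)) * Real.exp (-(b / 2) * τ) =
        Real.exp (-(τ / 2) * ((β - μ) ⬝ᵥ M.mulVec (β - μ))) *
          Real.exp (-((r + b) / 2 * τ)) := by
      rw [← Real.exp_add, ← Real.exp_add, ← Real.exp_add]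
      congr 1
      linear_combination (-(τ / 2)) * hsquare β
    calc
      _ = ∫ β : Fin d → ℝ, ((2 * π) ^ (-(n : ℝ) / 2) * τ ^ ((n : ℝ) / 2) *
            ((2 * π) ^ (-(d : ℝ) / 2) * τ ^ ((d : ℝ) / 2) * √Q.det) *
            ((b / 2) ^ (a / 2) / Real.Gamma (a / 2) * τ ^ (a / 2 - 1)) *
            Real.exp (-((r + b) / 2 * τ))) *
            Real.exp (-(τ / 2) * ((β - μ) ⬝ᵥ M.mulVec (β - μ))) := by
        congr 1 with β
        linear_combination ((2 * π) ^ (-(n : ℝ) / 2) * τ ^ ((n : ℝ) / 2) *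
            ((2 * π) ^ (-(d : ℝ) / 2) * τ ^ ((d : ℝ) / 2) * √Q.det) *
            ((b / 2) ^ (a / 2) / Real.Gamma (a / 2) * τ ^ (a / 2 - 1))) * hexp β
      _ = _ := by
        rw [integral_const_mul, integral_sub_right_eq_self
          (fun β : Fin d → ℝ ↦ Real.exp (-(τ / 2) * (β ⬝ᵥ M.mulVec β))) μ,
          integral_exp_neg_half_mul_quadratic hMpos τ, Fintype.card_fin]
        have hd : (2 * π) ^ (-(d : ℝ) / 2) * τ ^ ((d : ℝ) / 2) * √(2 * π / τ) ^ d = 1 := by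
          rw [Real.sqrt_eq_rpow, ← Real.rpow_mul_natCast (by positivity),
            Real.div_rpow (by positivity) hτ.le, neg_div, Real.rpow_neg (by positivity),
            one_div_mul_eq_div]
          field_simp
        have hn : τ ^ (((n : ℝ) + a) / 2 - 1) = τ ^ ((n : ℝ) / 2) * τ ^ (a / 2 - 1) := by
          rw [← Real.rpow_add hτ]; congr 1; ring
        rw [hn]
        linear_combination ((2 * π) ^ (-(n : ℝ) / 2) * τ ^ ((n : ℝ) / 2) * √Q.det *
            ((b / 2) ^ (a / 2) / Real.Gamma (a / 2) * τ ^ (a / 2 - 1)) *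
            Real.exp (-((r + b) / 2 * τ)) * (√M.det)⁻¹) * hd
  rw [setIntegral_congr_fun measurableSet_Ioi hinner, integral_const_mul,
    Real.integral_rpow_mul_exp_neg_mul_Ioi hp (half_pos hs), one_div, inv_div]
  have hsQ : 0 < √Q.det := Real.sqrt_pos.mpr hQd
  have hsM : 0 < √M.det := Real.sqrt_pos.mpr hMd
  rw [Real.log_mul (by positivity) (by positivity), Real.log_mul (by positivity) (by positivity),
    Real.log_mul (by positivity) (by positivity), Real.log_div (by positivity) (by positivity),
    Real.log_mul (by positivity) (by positivity), Real.log_mul (by positivity) (by positivity),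
    Real.log_inv, Real.log_sqrt hQd.le, Real.log_sqrt hMd.le,
    Real.log_rpow (by positivity), Real.log_rpow (by positivity), Real.log_rpow (by positivity),
    Real.log_mul two_ne_zero Real.pi_ne_zero, Real.log_div hb.ne' two_ne_zero,
    Real.log_div two_ne_zero hs.ne', Real.log_div hΓ.ne' hΓa.ne', Real.log_div hQd.ne' hMd.ne']
  ring
end
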